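/- Let d≥1, let F₁,…,F_d be integrable functions on (0,∞), and let k≥0. Assume that each Fᵢ is k-times differentiable on (0,∞), that for all 1≤i,j≤d the convolution Fᵢ*Fⱼ is analytic at zero, and that for every 0≤l≤k and every 1≤i≤d the function x ↦ x^l·Fᵢ^{(l)}(x) has property 𝒲. Then the function x ↦ x^k·(F₁*⋯*F_d)^{(k)}(x) also has property 𝒲. -/

import Mathlib

open MeasureTheory Set

/-- Convolution of two real functions. -/
noncomputable def conv (F G : ℝ → ℝ) : ℝ → ℝ := fun x => ∫ y, F y * G (x - y)

/-- Iterated convolution of a list of functions. -/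
noncomputable def multiConv : List (ℝ → ℝ) → (ℝ → ℝ)
  | [] => fun _ => 0
  | [f] => f
  | f :: g :: fs => conv f (multiConv (g :: fs))

/-- Property `𝒲`: exponential decay at infinity and an integrable power
singularity at `0`. -/
def PropW (F : ℝ → ℝ) : Prop :=
  ∃ A : ℝ, 1 < A ∧ ∃ t : ℝ, 0 ≤ t ∧ ∃ r ∈ Set.Ioo (-1 : ℝ) 0,
    (∀ x : ℝ, t < |x| → |F x| < A * Real.exp (-|x| / A)) ∧
    (∀ x : ℝ, 0 < |x| → |x| < t → |F x| < A * |x| ^ r)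

/-- A function defined on a right neighbourhood of `0` is analytic at zero if it
extends to a function analytic on an interval around `0`. -/
def AnalyticAtZeroRight (F : ℝ → ℝ) : Prop :=
  ∃ ε > (0:ℝ), ∃ g : ℝ → ℝ, (∀ x ∈ Set.Ioo (-ε) ε, AnalyticAt ℝ g x) ∧
    ∀ x ∈ Set.Ioo (0:ℝ) ε, g x = F x

/-- `F` has an integrable power singularity at `0⁺` and decays exponentially at `+∞`. -/
def SingDecay (F : ℝ → ℝ) : Prop :=
  ∃ C ≥ (0:ℝ), ∃ r ∈ Ioo (-1 : ℝ) 0, ∃ a > (0:ℝ),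
    ∀ x > (0:ℝ), |F x| ≤ C * (x ^ r * Real.exp (-a * x))

/-- A dilation-invariant form of `C^k` regularity: `F` vanishes on `(-∞, 0]` and its iterates under
the Euler operator `x d/dx` up to order `k` are continuous on `(0, ∞)` and satisfy `SingDecay`. -/
def EulerClass : ℕ → (ℝ → ℝ) → Prop
  | 0, F => (∀ x ≤ (0:ℝ), F x = 0) ∧ ContinuousOn F (Ioi 0) ∧ SingDecay F
  | k + 1, F => ((∀ x ≤ (0:ℝ), F x = 0) ∧ ContinuousOn F (Ioi 0) ∧ SingDecay F) ∧
      DifferentiableOn ℝ F (Ioi 0) ∧ EulerClass k (fun x => x * deriv F x)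

theorem exists_rpow_mul_exp_le {r r' a a' : ℝ} (hr : r' ≤ r) (ha : a' < a) :
    ∃ K ≥ (0:ℝ), ∀ x > (0:ℝ),
      x ^ r * Real.exp (-a * x) ≤ K * (x ^ r' * Real.exp (-a' * x)) := by
  set p := r - r' with hp
  set b := a - a' with hb
  have hp0 : 0 ≤ p := by linarith
  have hb0 : 0 < b := by linarith
  refine ⟨((p + 1) / b) ^ p, by positivity, fun x hx => ?_⟩
  have key : x ^ p ≤ ((p + 1) / b) ^ p * Real.exp (b * x) := by
    have h1 : b * x / (p + 1) ≤ Real.exp (b * x / (p + 1)) := by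
      linarith [Real.add_one_le_exp (b * x / (p + 1))]
    have h2 : (b * x / (p + 1)) ^ p ≤ Real.exp (b * x) := by
      calc (b * x / (p + 1)) ^ p ≤ Real.exp (b * x / (p + 1)) ^ p :=
            Real.rpow_le_rpow (by positivity) h1 hp0
        _ = Real.exp (b * x / (p + 1) * p) := by rw [Real.exp_mul]
        _ ≤ Real.exp (b * x) := by
            apply Real.exp_le_exp.2
            rw [div_mul_eq_mul_div, div_le_iff₀ (by positivity)]
            nlinarith [mul_pos hb0 hx]
    calc x ^ p = ((p + 1) / b * (b * x / (p + 1))) ^ p := by congr 1; field_simp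
      _ = ((p + 1) / b) ^ p * (b * x / (p + 1)) ^ p :=
          Real.mul_rpow (by positivity) (by positivity)
      _ ≤ _ := by gcongr
  have e1 : x ^ r = x ^ p * x ^ r' := by rw [← Real.rpow_add hx]; congr 1; ring
  have e2 : Real.exp (-a' * x) = Real.exp (b * x) * Real.exp (-a * x) := by
    rw [← Real.exp_add]; congr 1; ring
  rw [e1, e2]
  calc x ^ p * x ^ r' * Real.exp (-a * x)
      ≤ (((p + 1) / b) ^ p * Real.exp (b * x)) * x ^ r' * Real.exp (-a * x) := by gcongr
    _ = _ := by ring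

namespace SingDecay

variable {F G : ℝ → ℝ}

theorem congr (hF : SingDecay F) (h : ∀ x > (0:ℝ), G x = F x) : SingDecay G := by
  obtain ⟨C, hC, r, hr, a, ha, hb⟩ := hF
  exact ⟨C, hC, r, hr, a, ha, fun x hx => by rw [h x hx]; exact hb x hx⟩

theorem const_mul (hF : SingDecay F) (c : ℝ) : SingDecay (fun x => c * F x) := by
  obtain ⟨C, hC, r, hr, a, ha, hb⟩ := hF
  refine ⟨|c| * C, by positivity, r, hr, a, ha, fun x hx => ?_⟩
  rw [abs_mul, mul_assoc]
  exact mul_le_mul_of_nonneg_left (hb x hx) (abs_nonneg c)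

theorem add (hF : SingDecay F) (hG : SingDecay G) : SingDecay (fun x => F x + G x) := by
  obtain ⟨C, hC, r, hr, a, ha, hb⟩ := hF
  obtain ⟨C', hC', r', hr', a', ha', hb'⟩ := hG
  have hm : 0 < min a a' := lt_min ha ha'
  obtain ⟨K, hK, h⟩ := exists_rpow_mul_exp_le (min_le_left r r')
    (show min a a' / 2 < a by linarith [min_le_left a a'])
  obtain ⟨K', hK', h'⟩ := exists_rpow_mul_exp_le (min_le_right r r')
    (show min a a' / 2 < a' by linarith [min_le_right a a'])
  refine ⟨C * K + C' * K', by positivity, min r r', ⟨lt_min hr.1 hr'.1, min_lt_of_left_lt hr.2⟩,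
    min a a' / 2, by positivity, fun x hx => (abs_add_le _ _).trans ?_⟩
  have := mul_le_mul_of_nonneg_left (h x hx) hC
  have := mul_le_mul_of_nonneg_left (h' x hx) hC'
  linarith [hb x hx, hb' x hx]

theorem exists_bound_comp_mul (hF : SingDecay F) :
    ∃ r ∈ Ioo (-1 : ℝ) 0, ∀ m > (0:ℝ), ∃ C ≥ (0:ℝ), ∀ x ≥ m, ∀ s > (0:ℝ),
      |F (x * s)| ≤ C * s ^ r := by
  obtain ⟨C, hC, r, hr, a, ha, hb⟩ := hF
  refine ⟨r, hr, fun m hm => ⟨C * m ^ r, by positivity, fun x hx s hs => ?_⟩⟩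
  have hx0 : 0 < x := hm.trans_le hx
  refine (hb _ (by positivity)).trans ?_
  rw [mul_assoc C]
  refine mul_le_mul_of_nonneg_left ?_ hC
  rw [Real.mul_rpow hx0.le hs.le]
  have h1 : x ^ r ≤ m ^ r := Real.rpow_le_rpow_of_nonpos hm hx hr.2.le
  have h2 : Real.exp (-a * (x * s)) ≤ 1 := Real.exp_le_one_iff.2 (by
    have : 0 < a * (x * s) := by positivity
    linarith)
  calc x ^ r * s ^ r * Real.exp (-a * (x * s)) ≤ x ^ r * s ^ r * 1 := by gcongr
    _ ≤ m ^ r * s ^ r := by rw [mul_one]; gcongr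

end SingDecay

theorem integrableOn_rpow_mul_one_sub_rpow {r q : ℝ} (hr : -1 < r) (hq : -1 < q) :
    IntegrableOn (fun s : ℝ => s ^ r * (1 - s) ^ q) (Ioo 0 1) := by
  have h := (Complex.betaIntegral_convergent (u := ((r + 1 : ℝ) : ℂ)) (v := ((q + 1 : ℝ) : ℂ))
    (by simp; linarith) (by simp; linarith)).norm
  rw [intervalIntegrable_iff_integrableOn_Ioo_of_le zero_le_one] at h
  refine h.congr_fun (fun s hs => ?_) measurableSet_Ioo
  have h1 : (0:ℝ) < 1 - s := by linarith [hs.2]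
  have e : (1 - (s:ℂ)) = ((1 - s : ℝ) : ℂ) := by push_cast; rfl
  simp only [norm_mul]
  rw [e, Complex.norm_cpow_eq_rpow_re_of_pos hs.1, Complex.norm_cpow_eq_rpow_re_of_pos h1]
  simp

theorem SingDecay.exists_integrable_bound {F G : ℝ → ℝ} (hF : SingDecay F) (hG : SingDecay G)
    {m : ℝ} (hm : 0 < m) :
    ∃ b : ℝ → ℝ, IntegrableOn b (Ioo 0 1) ∧
      ∀ x ≥ m, ∀ s ∈ Ioo (0:ℝ) 1, |F (x * s) * G (x * (1 - s))| ≤ b s := by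
  obtain ⟨r, hr, h⟩ := hF.exists_bound_comp_mul
  obtain ⟨q, hq, h'⟩ := hG.exists_bound_comp_mul
  obtain ⟨C, hC, h⟩ := h m hm
  obtain ⟨C', hC', h'⟩ := h' m hm
  refine ⟨fun s => C * C' * (s ^ r * (1 - s) ^ q),
    (integrableOn_rpow_mul_one_sub_rpow hr.1 hq.1).const_mul _, fun x hx s hs => ?_⟩
  have h1 : (0:ℝ) < 1 - s := by linarith [hs.2]
  have := hs.1
  rw [abs_mul]
  calc |F (x * s)| * |G (x * (1 - s))| ≤ (C * s ^ r) * (C' * (1 - s) ^ q) := by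
        gcongr
        · exact h x hx s hs.1
        · exact h' x hx _ h1
    _ = _ := by ring

section Conv

variable {F G : ℝ → ℝ}

theorem conv_eq_zero_of_nonpos (hF : ∀ x ≤ (0:ℝ), F x = 0) (hG : ∀ x ≤ (0:ℝ), G x = 0)
    {x : ℝ} (hx : x ≤ 0) : conv F G x = 0 := by
  have : (fun y => F y * G (x - y)) = fun _ => 0 := by
    ext y
    rcases le_or_gt y 0 with h | h
    · rw [hF y h, zero_mul]
    · rw [hG _ (by linarith), mul_zero]
  simp [conv, this]

theorem conv_eq_mul_integral (hF : ∀ x ≤ (0:ℝ), F x = 0) (hG : ∀ x ≤ (0:ℝ), G x = 0)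
    {x : ℝ} (hx : 0 < x) :
    conv F G x = x * ∫ s in Ioo (0:ℝ) 1, F (x * s) * G (x * (1 - s)) := by
  have h := Measure.integral_comp_mul_left (fun y => F y * G (x - y)) x
  have e : ∫ s in Ioo (0:ℝ) 1, F (x * s) * G (x * (1 - s)) =
      ∫ s, F (x * s) * G (x - x * s) := by
    simp only [mul_sub, mul_one]
    refine setIntegral_eq_integral_of_forall_compl_eq_zero fun s hs => ?_
    rcases le_or_gt s 0 with h | h
    · rw [hF _ (mul_nonpos_of_nonneg_of_nonpos hx.le h), zero_mul]
    · have : 1 ≤ s := by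
        by_contra! h1
        exact hs ⟨h, h1⟩
      rw [hG (x - x * s) (by nlinarith), mul_zero]
  rw [e, h, abs_of_pos (inv_pos.2 hx), smul_eq_mul, mul_inv_cancel_left₀ hx.ne']
  rfl

theorem continuousOn_mul_comp (hF : ContinuousOn F (Ioi 0)) (hG : ContinuousOn G (Ioi 0))
    {x : ℝ} (hx : 0 < x) :
    ContinuousOn (fun s => F (x * s) * G (x * (1 - s))) (Ioo 0 1) := by
  refine (hF.comp (by fun_prop) fun s hs => ?_).mul (hG.comp (by fun_prop) fun s hs => ?_)
  · exact mul_pos hx hs.1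
  · exact mul_pos hx (by linarith [hs.2])

theorem integrableOn_mul_comp (hF : ContinuousOn F (Ioi 0)) (hG : ContinuousOn G (Ioi 0))
    (hF' : SingDecay F) (hG' : SingDecay G) {x : ℝ} (hx : 0 < x) :
    IntegrableOn (fun s => F (x * s) * G (x * (1 - s))) (Ioo 0 1) := by
  obtain ⟨b, hb, h⟩ := hF'.exists_integrable_bound hG' hx
  refine Integrable.mono' hb
    ((continuousOn_mul_comp hF hG hx).aestronglyMeasurable measurableSet_Ioo) ?_
  filter_upwards [ae_restrict_mem measurableSet_Ioo] with s hs
  exact h x le_rfl s hs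

theorem SingDecay.conv (hF0 : ∀ x ≤ (0:ℝ), F x = 0) (hG0 : ∀ x ≤ (0:ℝ), G x = 0)
    (hF : SingDecay F) (hG : SingDecay G) : SingDecay (conv F G) := by
  obtain ⟨C, hC, r, hr, a, ha, hb⟩ := hF
  obtain ⟨C', hC', q, hq, a', ha', hb'⟩ := hG
  set m := min a a' with hm
  have hm0 : 0 < m := lt_min ha ha'
  obtain ⟨K, hK, h⟩ := exists_rpow_mul_exp_le (show r ≤ 1 + r + q by linarith [hq.1])
    (show m / 2 < m by linarith)
  set β := ∫ s in Ioo (0:ℝ) 1, s ^ r * (1 - s) ^ q with hβ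
  have hβ0 : 0 ≤ β := setIntegral_nonneg measurableSet_Ioo fun s hs =>
    mul_nonneg (Real.rpow_nonneg hs.1.le _) (Real.rpow_nonneg (by linarith [hs.2]) _)
  refine ⟨C * C' * β * K, by positivity, r, hr, m / 2, by positivity, fun x hx => ?_⟩
  rw [conv_eq_mul_integral hF0 hG0 hx, abs_mul, abs_of_pos hx]
  have key : |∫ s in Ioo (0:ℝ) 1, F (x * s) * G (x * (1 - s))| ≤
      ∫ s in Ioo (0:ℝ) 1,
        C * C' * (x ^ r * x ^ q * Real.exp (-m * x)) * (s ^ r * (1 - s) ^ q) := by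
    rw [← Real.norm_eq_abs]
    refine norm_integral_le_of_norm_le
      (Integrable.const_mul (integrableOn_rpow_mul_one_sub_rpow hr.1 hq.1) _) ?_
    filter_upwards [ae_restrict_mem measurableSet_Ioo] with s hs
    have h1 : (0:ℝ) < 1 - s := by linarith [hs.2]
    have h0 : (0:ℝ) < s := hs.1
    have hexp : Real.exp (-a * (x * s)) * Real.exp (-a' * (x * (1 - s))) ≤ Real.exp (-m * x) := by
      rw [← Real.exp_add]
      apply Real.exp_le_exp.2
      have i1 : m * (x * s) ≤ a * (x * s) := by
        gcongr; exact min_le_left _ _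
      have i2 : m * (x * (1 - s)) ≤ a' * (x * (1 - s)) := by
        gcongr; exact min_le_right _ _
      linarith
    rw [norm_mul, Real.norm_eq_abs, Real.norm_eq_abs]
    calc |F (x * s)| * |G (x * (1 - s))|
        ≤ (C * ((x * s) ^ r * Real.exp (-a * (x * s)))) *
          (C' * ((x * (1 - s)) ^ q * Real.exp (-a' * (x * (1 - s))))) := by
          gcongr
          · exact hb _ (by positivity)
          · exact hb' _ (by positivity)
      _ = C * C' * (x ^ r * x ^ q * (s ^ r * (1 - s) ^ q)) *
          (Real.exp (-a * (x * s)) * Real.exp (-a' * (x * (1 - s)))) := by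
          rw [Real.mul_rpow hx.le h0.le, Real.mul_rpow hx.le h1.le]; ring
      _ ≤ C * C' * (x ^ r * x ^ q * (s ^ r * (1 - s) ^ q)) * Real.exp (-m * x) := by
          gcongr
      _ = _ := by ring
  rw [integral_const_mul] at key
  calc x * |∫ s in Ioo (0:ℝ) 1, F (x * s) * G (x * (1 - s))|
      ≤ x * (C * C' * (x ^ r * x ^ q * Real.exp (-m * x)) * β) := by gcongr
    _ = C * C' * β * (x ^ (1 + r + q) * Real.exp (-m * x)) := by
        rw [Real.rpow_add hx, Real.rpow_add hx, Real.rpow_one]; ring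
    _ ≤ C * C' * β * (K * (x ^ r * Real.exp (-(m / 2) * x))) := by
        exact mul_le_mul_of_nonneg_left (h x hx) (by positivity)
    _ = _ := by ring

theorem continuousOn_conv (hF0 : ∀ x ≤ (0:ℝ), F x = 0) (hG0 : ∀ x ≤ (0:ℝ), G x = 0)
    (hFc : ContinuousOn F (Ioi 0)) (hGc : ContinuousOn G (Ioi 0))
    (hF : SingDecay F) (hG : SingDecay G) : ContinuousOn (conv F G) (Ioi 0) := by
  suffices h : ContinuousOn
      (fun x => x * ∫ s in Ioo (0:ℝ) 1, F (x * s) * G (x * (1 - s))) (Ioi 0) from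
    h.congr fun x hx => conv_eq_mul_integral hF0 hG0 hx
  refine continuousOn_id.mul fun x hx => ContinuousAt.continuousWithinAt ?_
  have hx : 0 < x := hx
  obtain ⟨b, hb, h⟩ := hF.exists_integrable_bound hG (half_pos hx)
  refine continuousAt_of_dominated (bound := b) ?_ ?_ hb ?_
  · filter_upwards [Ioi_mem_nhds hx] with y hy
    exact (continuousOn_mul_comp hFc hGc hy).aestronglyMeasurable measurableSet_Ioo
  · filter_upwards [Ioi_mem_nhds (half_lt_self hx)] with y hy
    filter_upwards [ae_restrict_mem measurableSet_Ioo] with s hs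
    exact h y (le_of_lt hy) s hs
  · filter_upwards [ae_restrict_mem measurableSet_Ioo] with s hs
    have h1 : 0 < x * s := mul_pos hx hs.1
    have h2 : 0 < x * (1 - s) := mul_pos hx (by linarith [hs.2])
    exact (ContinuousAt.comp (f := fun y => y * s) (hFc.continuousAt (Ioi_mem_nhds h1))
      (by fun_prop)).mul
      (ContinuousAt.comp (f := fun y => y * (1 - s)) (hGc.continuousAt (Ioi_mem_nhds h2))
      (by fun_prop))

/-- Differentiation of a convolution along dilations. -/
theorem hasDerivAt_conv (hF0 : ∀ x ≤ (0:ℝ), F x = 0) (hG0 : ∀ x ≤ (0:ℝ), G x = 0)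
    (hFd : DifferentiableOn ℝ F (Ioi 0)) (hGd : DifferentiableOn ℝ G (Ioi 0))
    (hFc : ContinuousOn (fun x => x * deriv F x) (Ioi 0))
    (hGc : ContinuousOn (fun x => x * deriv G x) (Ioi 0))
    (hF : SingDecay F) (hG : SingDecay G)
    (hF' : SingDecay (fun x => x * deriv F x)) (hG' : SingDecay (fun x => x * deriv G x))
    (hF0' : ∀ x ≤ (0:ℝ), x * deriv F x = 0) (hG0' : ∀ x ≤ (0:ℝ), x * deriv G x = 0)
    {x : ℝ} (hx : 0 < x) :
    HasDerivAt (conv F G) (x⁻¹ * (conv F G x + conv (fun x => x * deriv F x) G x +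
      conv F (fun x => x * deriv G x) x)) x := by
  set F' := fun x => x * deriv F x with hF'd
  set G' := fun x => x * deriv G x with hG'd
  have hFc0 := hFd.continuousOn
  have hGc0 := hGd.continuousOn
  obtain ⟨b, hb, h⟩ := hF'.exists_integrable_bound hG (half_pos hx)
  obtain ⟨b', hb', h'⟩ := hF.exists_integrable_bound hG' (half_pos hx)
  have key := hasDerivAt_integral_of_dominated_loc_of_deriv_le
    (μ := volume.restrict (Ioo (0:ℝ) 1)) (x₀ := x) (s := Ioi (x / 2))
    (bound := fun s => (x / 2)⁻¹ * (b s + b' s))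
    (F := fun x s => F (x * s) * G (x * (1 - s)))
    (F' := fun x s => x⁻¹ * (F' (x * s) * G (x * (1 - s)) + F (x * s) * G' (x * (1 - s))))
    (Ioi_mem_nhds (half_lt_self hx))
    (by
      filter_upwards [Ioi_mem_nhds hx] with y hy
      exact (continuousOn_mul_comp hFc0 hGc0 hy).aestronglyMeasurable measurableSet_Ioo)
    (integrableOn_mul_comp hFc0 hGc0 hF hG hx)
    (((integrableOn_mul_comp hFc hGc0 hF' hG hx).add
      (integrableOn_mul_comp hFc0 hGc hF hG' hx)).const_mul _).aestronglyMeasurable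
    (by
      filter_upwards [ae_restrict_mem measurableSet_Ioo] with s hs y hy
      have hy : x / 2 < y := hy
      have hy0 : 0 < y := by linarith
      rw [norm_mul, norm_inv, Real.norm_of_nonneg hy0.le]
      gcongr
      exact (norm_add_le _ _).trans (add_le_add (h y hy.le s hs) (h' y hy.le s hs)))
    ((hb.add hb').const_mul _)
    (by
      filter_upwards [ae_restrict_mem measurableSet_Ioo] with s hs y hy
      have hy : x / 2 < y := hy
      have hy0 : 0 < y := by linarith
      have h1 : 0 < y * s := mul_pos hy0 hs.1
      have h2 : 0 < y * (1 - s) := mul_pos hy0 (by linarith [hs.2])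
      have d1 := ((hFd.differentiableAt (Ioi_mem_nhds h1)).hasDerivAt).comp y
        ((hasDerivAt_id y).mul_const s)
      have d2 := ((hGd.differentiableAt (Ioi_mem_nhds h2)).hasDerivAt).comp y
        ((hasDerivAt_id y).mul_const (1 - s))
      refine (d1.mul d2).congr_deriv ?_
      simp only [hF'd, hG'd, Function.comp, id]
      field_simp)
  have key2 := (hasDerivAt_id x).mul key.2
  have ev : conv F G =ᶠ[nhds x]
      (id * fun x => ∫ s in Ioo (0:ℝ) 1, F (x * s) * G (x * (1 - s))) := by
    filter_upwards [Ioi_mem_nhds hx] with y hy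
    exact conv_eq_mul_integral hF0 hG0 hy
  refine (key2.congr_of_eventuallyEq ev).congr_deriv ?_
  rw [integral_const_mul, integral_add (integrableOn_mul_comp hFc hGc0 hF' hG hx)
    (integrableOn_mul_comp hFc0 hGc hF hG' hx), conv_eq_mul_integral hF0 hG0 hx,
    conv_eq_mul_integral hF0' hG0 hx, conv_eq_mul_integral hF0 hG0' hx]
  rw [id, mul_inv_cancel_left₀ hx.ne', one_mul, ← mul_add, ← mul_add,
    inv_mul_cancel_left₀ hx.ne', add_assoc]

end Conv

theorem id_mul_deriv_eq_zero_of_nonpos {F : ℝ → ℝ} (h0 : ∀ x ≤ (0:ℝ), F x = 0) :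
    ∀ x ≤ (0:ℝ), x * deriv F x = 0 := by
  intro x hx
  rcases hx.lt_or_eq with hx | rfl
  · have ev : F =ᶠ[nhds x] fun _ => 0 := by
      filter_upwards [Iio_mem_nhds hx] with y hy using h0 y (le_of_lt hy)
    rw [ev.deriv_eq, deriv_const, mul_zero]
  · simp

namespace EulerClass

theorem zero : ∀ {k : ℕ} {F : ℝ → ℝ}, EulerClass k F → EulerClass 0 F
  | 0, _, h => h
  | _ + 1, _, h => h.1

theorem of_succ : ∀ {k : ℕ} {F : ℝ → ℝ}, EulerClass (k + 1) F → EulerClass k F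
  | 0, _, h => h.1
  | _ + 1, _, h => ⟨h.1, h.2.1, of_succ h.2.2⟩

theorem add {k : ℕ} {F G : ℝ → ℝ} (hF : EulerClass k F) (hG : EulerClass k G) :
    EulerClass k (fun x => F x + G x) := by
  have base : ∀ {F G : ℝ → ℝ}, EulerClass 0 F → EulerClass 0 G →
      EulerClass 0 (fun x => F x + G x) := fun hF hG =>
    ⟨fun x hx => by simp [hF.1 x hx, hG.1 x hx], hF.2.1.add hG.2.1, hF.2.2.add hG.2.2⟩
  induction k generalizing F G with
  | zero => exact base hF hG
  | succ k ih =>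
    refine ⟨base hF.1 hG.1, hF.2.1.add hG.2.1, ?_⟩
    convert ih hF.2.2 hG.2.2 using 2 with x
    rcases le_or_gt x 0 with hx | hx
    · have h := id_mul_deriv_eq_zero_of_nonpos (base hF.1 hG.1).1 x hx
      rw [h, id_mul_deriv_eq_zero_of_nonpos hF.1.1 x hx,
        id_mul_deriv_eq_zero_of_nonpos hG.1.1 x hx, add_zero]
    · have := deriv_fun_add (hF.2.1.differentiableAt (Ioi_mem_nhds hx))
        (hG.2.1.differentiableAt (Ioi_mem_nhds hx))
      rw [this, mul_add]

theorem conv {k : ℕ} {F G : ℝ → ℝ} (hF : EulerClass k F) (hG : EulerClass k G) :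
    EulerClass k (conv F G) := by
  have base : ∀ {F G : ℝ → ℝ}, EulerClass 0 F → EulerClass 0 G →
      EulerClass 0 (_root_.conv F G) := fun hF hG =>
    ⟨fun x hx => conv_eq_zero_of_nonpos hF.1 hG.1 hx,
      continuousOn_conv hF.1 hG.1 hF.2.1 hG.2.1 hF.2.2 hG.2.2,
      SingDecay.conv hF.1 hG.1 hF.2.2 hG.2.2⟩
  induction k generalizing F G with
  | zero => exact base hF hG
  | succ k ih =>
    have hF' := hF.2.2.zero
    have hG' := hG.2.2.zero
    have hd : ∀ x > (0:ℝ), _ := fun x hx => hasDerivAt_conv hF.1.1 hG.1.1 hF.2.1 hG.2.1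
      hF'.2.1 hG'.2.1 hF.1.2.2 hG.1.2.2 hF'.2.2 hG'.2.2 hF'.1 hG'.1 hx
    refine ⟨base hF.1 hG.1,
      fun x hx => (hd x hx).differentiableAt.differentiableWithinAt, ?_⟩
    convert ((ih hF.of_succ hG.of_succ).add (ih hF.2.2 hG.of_succ)).add (ih hF.of_succ hG.2.2)
      using 2 with x
    rcases le_or_gt x 0 with hx | hx
    · have h := id_mul_deriv_eq_zero_of_nonpos (base hF.1 hG.1).1 x hx
      rw [h, conv_eq_zero_of_nonpos hF.1.1 hG.1.1 hx, conv_eq_zero_of_nonpos hF'.1 hG.1.1 hx,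
        conv_eq_zero_of_nonpos hF.1.1 hG'.1 hx]
      simp
    · rw [(hd x hx).deriv, mul_inv_cancel_left₀ hx.ne']

theorem multiConv {k : ℕ} : ∀ {l : List (ℝ → ℝ)}, l ≠ [] → (∀ F ∈ l, EulerClass k F) →
    EulerClass k (multiConv l)
  | [f], _, h => h f (by simp)
  | f :: g :: fs, _, h => (h f (by simp)).conv
      (multiConv (l := g :: fs) (by simp) fun F hF => h F (List.mem_cons_of_mem _ hF))

end EulerClass

theorem iteratedDeriv_id_mul_deriv {F : ℝ → ℝ} {k : ℕ} (hF : ContDiffOn ℝ (k + 1 : ℕ) F (Ioi 0)) :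
    ∀ l ≤ k, ∀ x > (0:ℝ), iteratedDeriv l (fun x => x * deriv F x) x =
      x * iteratedDeriv (l + 1) F x + l * iteratedDeriv l F x := by
  have hdiff : ∀ l ≤ k, ∀ x > (0:ℝ), DifferentiableAt ℝ (iteratedDeriv l F) x := fun l hl x hx =>
    ((hF.differentiableOn_iteratedDerivWithin (by exact_mod_cast Nat.lt_succ_of_le hl)
      isOpen_Ioi.uniqueDiffOn).congr fun _ hy =>
        (iteratedDerivWithin_of_isOpen isOpen_Ioi hy).symm).differentiableAt (Ioi_mem_nhds hx)
  intro l
  induction l with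
  | zero => intro _ x hx; simp [iteratedDeriv_one]
  | succ l ih =>
    intro hl x hx
    have ev : iteratedDeriv l (fun x => x * deriv F x) =ᶠ[nhds x]
        fun x => x * iteratedDeriv (l + 1) F x + l * iteratedDeriv l F x := by
      filter_upwards [Ioi_mem_nhds hx] with y hy using ih (by omega) y hy
    have d1 := (hdiff (l + 1) hl x hx).hasDerivAt
    have d0 := (hdiff l (by omega) x hx).hasDerivAt
    rw [← iteratedDeriv_succ] at d1 d0
    rw [iteratedDeriv_succ, ev.deriv_eq]
    refine (((hasDerivAt_id x).mul d1).add (d0.const_mul (l:ℝ))).deriv.trans ?_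
    simp only [id]
    push_cast
    ring

theorem eulerClass_of_contDiffOn {F : ℝ → ℝ} {k : ℕ} (h0 : ∀ x ≤ (0:ℝ), F x = 0)
    (hF : ContDiffOn ℝ k F (Ioi 0))
    (hd : ∀ l ≤ k, SingDecay (fun x => x ^ l * iteratedDeriv l F x)) : EulerClass k F := by
  have base {F : ℝ → ℝ} {k : ℕ} (hd : ∀ l ≤ k, SingDecay (fun x => x ^ l * iteratedDeriv l F x)) :
      SingDecay F := (hd 0 (Nat.zero_le k)).congr fun x _ => by simp
  induction k generalizing F with
  | zero => exact ⟨h0, hF.continuousOn, base hd⟩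
  | succ k ih =>
    refine ⟨⟨h0, hF.continuousOn, base hd⟩, hF.differentiableOn (by simp),
      ih (id_mul_deriv_eq_zero_of_nonpos h0) ?_ fun l hl => ?_⟩
    · exact contDiffOn_id.mul (hF.deriv_of_isOpen isOpen_Ioi (by simp))
    · refine ((hd (l + 1) (by omega)).add ((hd l (by omega)).const_mul l)).congr fun x hx => ?_
      simp only [iteratedDeriv_id_mul_deriv hF l hl x hx]
      ring

namespace EulerClass

theorem contDiffOn {k : ℕ} {F : ℝ → ℝ} (hF : EulerClass k F) : ContDiffOn ℝ k F (Ioi 0) := by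
  induction k generalizing F with
  | zero => exact contDiffOn_zero.2 hF.2.1
  | succ k ih =>
    push_cast
    rw [contDiffOn_succ_iff_deriv_of_isOpen isOpen_Ioi]
    refine ⟨hF.2.1, by simp, ?_⟩
    refine ((ih hF.2.2).mul (contDiffOn_id.inv fun x hx => ne_of_gt hx)).congr fun x hx => ?_
    have : x ≠ 0 := ne_of_gt hx
    change deriv F x = x * deriv F x * x⁻¹
    field_simp

theorem singDecay_iteratedDeriv {k : ℕ} {F : ℝ → ℝ} (hF : EulerClass k F) :
    ∀ l ≤ k, SingDecay (fun x => x ^ l * iteratedDeriv l F x) := by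
  induction k generalizing F with
  | zero =>
    intro l hl
    obtain rfl : l = 0 := by omega
    exact hF.2.2.congr fun x _ => by simp
  | succ k ih =>
    intro l hl
    rcases hl.lt_or_eq with hl | rfl
    · exact ih hF.of_succ l (by omega)
    · refine ((ih hF.2.2 k le_rfl).add ((ih hF.of_succ k le_rfl).const_mul (-k))).congr
        fun x hx => ?_
      simp only [iteratedDeriv_id_mul_deriv hF.contDiffOn k le_rfl x hx]
      ring

end EulerClass

theorem PropW.singDecay {F : ℝ → ℝ} (hF : PropW F) : SingDecay F := by
  obtain ⟨A, hA, t, ht, r, hr, h1, h2⟩ := hF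
  have hA0 : 0 < A := by linarith
  have ha : 0 < A⁻¹ := inv_pos.2 hA0
  obtain ⟨K, hK, hb⟩ := exists_rpow_mul_exp_le hr.2.le (show A⁻¹ / 2 < A⁻¹ by linarith)
  set a := A⁻¹ / 2 with had
  have ha0 : 0 < a := by positivity
  refine ⟨A * K + A * Real.exp (a * t) + |F t| / (t ^ r * Real.exp (-a * t)),
    by positivity, r, hr, a, ha0, fun x hx => ?_⟩
  have hpos : 0 < x ^ r * Real.exp (-a * x) := by positivity
  have n1 : 0 ≤ A * K := by positivity
  have n2 : 0 ≤ A * Real.exp (a * t) := by positivity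
  have n3 : 0 ≤ |F t| / (t ^ r * Real.exp (-a * t)) := by positivity
  rcases lt_trichotomy x t with hxt | rfl | hxt
  · have h := (h2 x (by rwa [abs_of_pos hx]) (by rwa [abs_of_pos hx])).le
    rw [abs_of_pos hx] at h
    have e : 1 ≤ Real.exp (a * t) * Real.exp (-a * x) := by
      rw [← Real.exp_add]
      exact Real.one_le_exp (by nlinarith)
    calc |F x| ≤ A * x ^ r * 1 := by rwa [mul_one]
      _ ≤ A * x ^ r * (Real.exp (a * t) * Real.exp (-a * x)) := by gcongr
      _ = A * Real.exp (a * t) * (x ^ r * Real.exp (-a * x)) := by ring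
      _ ≤ _ := by gcongr; linarith
  · calc |F x| = |F x| / (x ^ r * Real.exp (-a * x)) * (x ^ r * Real.exp (-a * x)) := by
          field_simp
      _ ≤ _ := by gcongr; linarith
  · have h := (h1 x (by rwa [abs_of_pos hx])).le
    rw [abs_of_pos hx] at h
    have hb := hb x hx
    rw [Real.rpow_zero, one_mul, show -A⁻¹ * x = -x / A by ring] at hb
    calc |F x| ≤ A * Real.exp (-x / A) := h
      _ ≤ A * (K * (x ^ r * Real.exp (-a * x))) := by gcongr
      _ = A * K * (x ^ r * Real.exp (-a * x)) := by ring
      _ ≤ _ := by gcongr; linarith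

theorem SingDecay.propW {F : ℝ → ℝ} (hF : SingDecay F) (h0 : ∀ x < (0:ℝ), F x = 0) : PropW F := by
  obtain ⟨C, hC, r, hr, a, ha, hb⟩ := hF
  have hai : 0 < a⁻¹ := inv_pos.2 ha
  set A := C + a⁻¹ + 2 with hA
  have hA0 : 0 < A := by positivity
  have hCA : C < A := by linarith
  have hAa : A⁻¹ ≤ a := by
    rw [inv_le_comm₀ hA0 ha]; linarith
  refine ⟨A, by linarith, 1, zero_le_one, r, hr, fun x hx => ?_, fun x hx hx1 => ?_⟩
  · rcases lt_or_ge x 0 with h | h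
    · rw [h0 x h, abs_zero]; positivity
    · rw [abs_of_nonneg h] at hx ⊢
      have hx0 : 0 < x := by linarith
      have e : Real.exp (-a * x) ≤ Real.exp (-x / A) := Real.exp_le_exp.2 (by
        have : A⁻¹ * x ≤ a * x := by gcongr
        rw [div_eq_mul_inv]; linarith)
      calc |F x| ≤ C * (x ^ r * Real.exp (-a * x)) := hb x hx0
        _ ≤ C * (1 * Real.exp (-x / A)) := by
            gcongr
            exact Real.rpow_le_one_of_one_le_of_nonpos hx.le hr.2.le
        _ < A * Real.exp (-x / A) := by
            rw [one_mul]; gcongr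
  · rcases lt_or_ge x 0 with h | h
    · rw [h0 x h, abs_zero]; positivity
    · rw [abs_of_nonneg h] at hx ⊢
      have e : Real.exp (-a * x) ≤ 1 := Real.exp_le_one_iff.2 (by nlinarith)
      have : 0 < x ^ r := by positivity
      calc |F x| ≤ C * (x ^ r * Real.exp (-a * x)) := hb x hx
        _ ≤ C * (x ^ r * 1) := by gcongr
        _ < A * x ^ r := by rw [mul_one]; gcongr

/-- if each `x ↦ x^l·Fᵢ^{(l)}(x)` (`l ≤ k`) has property `𝒲` and all
pairwise convolutions are analytic at zero, then `x ↦ x^k·(F₁*⋯*F_d)^{(k)}(x)` has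
property `𝒲`. -/
theorem stmt11 (d : ℕ) (hd : 1 ≤ d) (k : ℕ) (F : Fin d → ℝ → ℝ)
    (hsupp : ∀ i, ∀ x ≤ (0:ℝ), F i x = 0)
    (hint : ∀ i, IntegrableOn (F i) (Ioi 0))
    (hdiff : ∀ i, ContDiffOn ℝ k (F i) (Ioi 0))
    (hanal : ∀ i j, AnalyticAtZeroRight (conv (F i) (F j)))
    (hW : ∀ l ≤ k, ∀ i, PropW (fun x => x ^ l * iteratedDeriv l (F i) x)) :
    PropW (fun x => x ^ k * iteratedDeriv k (multiConv (List.ofFn F)) x) := by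
  have hmem : EulerClass k (multiConv (List.ofFn F)) := by
    refine EulerClass.multiConv (by simpa using by omega) fun G hG => ?_
    obtain ⟨i, rfl⟩ := (List.mem_ofFn' F G).1 hG
    exact eulerClass_of_contDiffOn (hsupp i) (hdiff i) fun l hl => (hW l hl i).singDecay
  refine (hmem.singDecay_iteratedDeriv k le_rfl).propW fun x hx => ?_
  have ev : multiConv (List.ofFn F) =ᶠ[nhds x] fun _ => 0 := by
    filter_upwards [Iio_mem_nhds hx] with y hy using hmem.zero.1 y (le_of_lt hy)
  rw [ev.iteratedDeriv_eq k, iteratedDeriv_fun_const_zero, mul_zero]
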